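/- Let I and J be Z-lattices (full finitely generated sub-Z-modules) in an étale algebra K over the fraction field Q of a Dedekind domain Z. Then the trace dual satisfies I^t · J = (I : J)^t, where I^t = {a ∈ K : Tr_{K/Q}(aI) ⊆ Z} and (I:J) = {a ∈ K : aJ ⊆ I}. -/

import Mathlib

universe u

/-- A `Z`-lattice in `K`: a finitely generated `Z`-submodule containing a `Q`-basis of `K`. -/
def IsLat (Z : Type*) (Q K : Type u) [CommRing Z] [Field Q] [Algebra Z Q]
    [CommRing K] [Algebra Q K] [Algebra Z K] (I : Submodule Z K) : Prop :=
  I.FG ∧ Submodule.span Q (I : Set K) = ⊤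

variable (Z : Type*) (Q K : Type u) [CommRing Z] [IsDedekindDomain Z] [Field Q]
  [Algebra Z Q] [IsFractionRing Z Q] [CommRing K] [Algebra Q K] [Algebra Z K]
  [IsScalarTower Z Q K] [FiniteDimensional Q K] [Algebra.Etale Q K]

/-- The trace dual `I^t = {a ∈ K : Tr_{K/Q}(aI) ⊆ Z}` of a `Z`-submodule of `K`. -/
def tdual (I : Submodule Z K) : Submodule Z K where
  carrier := {a | ∀ x ∈ I, Algebra.trace Q K (a * x) ∈ (algebraMap Z Q).range}
  add_mem' := by
    intro a b ha hb x hx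
    rw [add_mul, map_add]
    exact add_mem (ha x hx) (hb x hx)
  zero_mem' := by
    intro x hx
    simp only [zero_mul, map_zero]
    exact zero_mem _
  smul_mem' := by
    intro z a ha x hx
    have h1 : (z • a) * x = a * (z • x) := by
      rw [smul_mul_assoc, mul_comm a x, ← smul_mul_assoc, mul_comm]
    rw [h1]
    exact ha (z • x) (I.smul_mem z hx)

/-- The trace form of an étale algebra over a field is nondegenerate. -/
theorem Algebra.Etale.traceForm_nondegenerate (Q K : Type u) [Field Q] [CommRing K]
    [Algebra Q K] [FiniteDimensional Q K] [Algebra.Etale Q K] :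
    (Algebra.traceForm Q K).Nondegenerate := by
  classical
  refine (LinearMap.IsRefl.nondegenerate_iff_separatingLeft
    (B := Algebra.traceForm Q K) (Algebra.traceForm_isSymm Q).isRefl).mpr ?_
  obtain ⟨ι, _, L, _, _, e, hL⟩ := (Algebra.Etale.iff_exists_algEquiv_prod Q K).mp inferInstance
  have := Fintype.ofFinite ι
  have hfin (i : ι) : FiniteDimensional Q (L i) := (hL i).1
  have hsep (i : ι) : Algebra.IsSeparable Q (L i) := (hL i).2
  have htr (i : ι) (a : L i) :
      Algebra.trace Q (Π j, L j) (Pi.single i a) = Algebra.trace Q (L i) a := by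
    have h₁ : Algebra.lmul Q (Π j, L j) (Pi.single i a) =
        LinearMap.single Q L i ∘ₗ (Algebra.lmul Q (L i) a ∘ₗ LinearMap.proj i) := by
      refine LinearMap.ext fun x ↦ ?_
      simp [← Pi.single_mul_left]
    have h₂ : (Algebra.lmul Q (L i) a ∘ₗ LinearMap.proj i) ∘ₗ LinearMap.single Q L i =
        Algebra.lmul Q (L i) a := by
      ext x
      simp
    rw [Algebra.trace_apply, Algebra.trace_apply, h₁, LinearMap.trace_comp_comm', h₂]
  intro x hx
  rw [← map_eq_zero_iff e e.injective]
  funext i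
  by_contra hxi
  obtain ⟨w, hw⟩ := Algebra.trace_surjective Q (L i) 1
  have h := hx (e.symm (Pi.single i ((e x i)⁻¹ * w)))
  rw [Algebra.traceForm_apply, ← Algebra.trace_eq_of_algEquiv e, map_mul, e.apply_symm_apply,
    ← Pi.single_mul_right, htr, mul_inv_cancel_left₀ hxi, hw] at h
  exact one_ne_zero h

variable {Z Q K}

/-- An `R`-linear form on a lattice extends to an `F`-linear form on the ambient algebra. -/
theorem IsLat.exists_extend {R : Type*} {F A : Type u} [CommRing R] [Field F] [Algebra R F]
    [IsFractionRing R F]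
    [CommRing A] [Algebra F A] [Algebra R A] [IsScalarTower R F A]
    {N : Submodule R A} (hN : IsLat R F A N) (f : N →ₗ[R] R) :
    ∃ g : A →ₗ[F] F, ∀ n : N, g n = algebraMap R F (f n) := by
  have hunit (M : Type u) [AddCommGroup M] [Module R M] [Module F M] [IsScalarTower R F M]
      (z : nonZeroDivisors R) : IsUnit (algebraMap R (Module.End R M) z) :=
    (isLocalizedModule_id (nonZeroDivisors R) M F).map_units z
  have : IsLocalizedModule (nonZeroDivisors R) N.subtype :=
    { map_units := hunit A
      surj := fun y ↦ by
        obtain ⟨t, ht⟩ := multiple_mem_span_of_mem_localization_span (nonZeroDivisors R) F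
          (N : Set A) y (hN.2 ▸ Submodule.mem_top)
        rw [Submodule.span_eq] at ht
        exact ⟨(⟨_, ht⟩, t), rfl⟩
      exists_of_eq := fun h ↦ ⟨1, by rw [N.injective_subtype h]⟩ }
  refine ⟨(IsLocalizedModule.lift (nonZeroDivisors R) N.subtype (Algebra.linearMap R F ∘ₗ f)
    (hunit F)).extendScalarsOfIsLocalization (nonZeroDivisors R) F, fun n ↦ ?_⟩
  exact IsLocalizedModule.lift_apply (nonZeroDivisors R) N.subtype _ (hunit F) n

/-- A lattice and its trace dual admit a finite dual system of generators. -/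
theorem IsLat.exists_dual_system {N : Submodule Z K} (hN : IsLat Z Q K N) :
    ∃ (n : ℕ) (x y : Fin n → K), (∀ i, x i ∈ N) ∧ (∀ i, y i ∈ tdual Z Q K N) ∧
      ∀ a, ∑ i, Algebra.trace Q K (y i * a) • x i = a := by
  have : Module.Finite Z N := Module.Finite.iff_fg.mpr hN.1
  have : Module.IsTorsionFree Z K := .trans_faithfulSMul Z Q K
  have : Module.FinitePresentation Z N := Module.finitePresentation_of_finite Z N
  have : Module.Projective Z N := Module.Flat.projective_of_finitePresentation
  obtain ⟨n, f, g, -, -, hfg⟩ := Module.Finite.exists_comp_eq_id_of_projective Z N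
  choose φ hφ using fun i ↦ hN.exists_extend (LinearMap.proj i ∘ₗ g)
  have hnd := Algebra.Etale.traceForm_nondegenerate Q K
  let y (i : Fin n) : K := ((Algebra.traceForm Q K).toDual hnd).symm (φ i)
  have hy (i : Fin n) (a : K) : Algebra.trace Q K (y i * a) = φ i a :=
    LinearMap.BilinForm.apply_toDual_symm_apply (hB := hnd) (φ i) a
  refine ⟨n, fun i ↦ f (Pi.single i 1), y, fun i ↦ (f _).2, fun i a ha ↦ ?_, fun a ↦ ?_⟩
  · exact ⟨_, (hφ i ⟨a, ha⟩).symm.trans (hy i a).symm⟩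
  · simp_rw [hy]
    have ha : a ∈ Submodule.span Q (N : Set K) := hN.2 ▸ Submodule.mem_top
    let p : K →ₗ[Q] K := ∑ i, (φ i).smulRight (f (Pi.single i 1) : K)
    have hp : Set.EqOn p (LinearMap.id : K →ₗ[Q] K) N := by
      intro m hm
      have h : f (g ⟨m, hm⟩) = ⟨m, hm⟩ := LinearMap.congr_fun hfg ⟨m, hm⟩
      rw [pi_eq_sum_univ' (g ⟨m, hm⟩), map_sum] at h
      have hφm (i : Fin n) : φ i m = algebraMap Z Q (g ⟨m, hm⟩ i) := hφ i ⟨m, hm⟩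
      simp only [map_smul] at h
      simpa [p, hφm, algebraMap_smul] using congrArg N.subtype h
    simpa [p] using LinearMap.eqOn_span hp ha

/-- The trace dual of a lattice is a lattice. -/
theorem IsLat.tdual {N : Submodule Z K} (hN : IsLat Z Q K N) : IsLat Z Q K (tdual Z Q K N) := by
  obtain ⟨n, x, y, hx, hy, h⟩ := hN.exists_dual_system
  have hdual (b : K) : ∑ i, Algebra.trace Q K (b * x i) • y i = b := by
    refine ((Algebra.traceForm Q K).toDual
      (Algebra.Etale.traceForm_nondegenerate Q K)).injective (LinearMap.ext fun a ↦ ?_)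
    simp only [LinearMap.BilinForm.toDual_def, Algebra.traceForm_apply]
    conv_rhs => rw [← h a]
    simp [Finset.mul_sum, mul_comm]
  constructor
  · have : _root_.tdual Z Q K N = Submodule.span Z (Set.range y) := by
      refine le_antisymm (fun b hb ↦ ?_) (Submodule.span_le.mpr ?_)
      · rw [← hdual b]
        refine sum_mem fun i _ ↦ ?_
        obtain ⟨z, hz⟩ := hb _ (hx i)
        rw [← hz, algebraMap_smul]
        exact Submodule.smul_mem _ _ (Submodule.subset_span ⟨i, rfl⟩)
      · rintro _ ⟨i, rfl⟩
        exact hy i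
    rw [this]
    exact Submodule.fg_span (Set.finite_range y)
  · refine eq_top_iff.mpr fun b _ ↦ ?_
    rw [← hdual b]
    exact sum_mem fun i _ ↦ Submodule.smul_mem _ _ (Submodule.subset_span (hy i))

/-- Lattices are reflexive for the trace dual. -/
theorem IsLat.tdual_tdual {N : Submodule Z K} (hN : IsLat Z Q K N) :
    _root_.tdual Z Q K (_root_.tdual Z Q K N) = N := by
  refine le_antisymm (fun a ha ↦ ?_) fun a ha b hb ↦ mul_comm b a ▸ hb a ha
  obtain ⟨n, x, y, hx, hy, h⟩ := hN.exists_dual_system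
  rw [← h a]
  refine sum_mem fun i _ ↦ ?_
  obtain ⟨z, hz⟩ := ha _ (hy i)
  rw [mul_comm, ← hz, algebraMap_smul]
  exact N.smul_mem z (hx i)

/-- The product of two lattices is a lattice. -/
theorem IsLat.mul {R : Type*} {F A : Type u} [CommRing R] [Field F] [Algebra R F]
    [CommRing A] [Algebra F A] [Algebra R A]
    {M N : Submodule R A} (hM : IsLat R F A M) (hN : IsLat R F A N) :
    IsLat R F A (M * N) := by
  refine ⟨hM.1.mul hN.1, eq_top_iff.mpr ?_⟩
  calc (⊤ : Submodule F A) ≤ ⊤ * ⊤ := fun a _ ↦ by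
        simpa using Submodule.mul_mem_mul (Submodule.mem_top (x := a)) (Submodule.mem_top (x := 1))
    _ ≤ Submodule.span F (M * N : Submodule R A) := by
        nth_rw 1 [← hM.2]
        rw [← hN.2, Submodule.span_mul_span, Submodule.span_le]
        rintro _ ⟨m, hm, n, hn, rfl⟩
        exact Submodule.subset_span (Submodule.mul_mem_mul hm hn)

/-- `(M · N)^t = (M^t : N)`. -/
theorem tdual_mul {R : Type*} {F A : Type u} [CommRing R] [Field F] [Algebra R F]
    [CommRing A] [Algebra F A] [Algebra R A]
    (M N : Submodule R A) : tdual R F A (M * N) = tdual R F A M / N := by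
  ext a
  rw [Submodule.mem_div_iff_forall_mul_mem]
  constructor
  · intro ha n hn m hm
    rw [mul_assoc, mul_comm n]
    exact ha _ (Submodule.mul_mem_mul hm hn)
  · intro ha x hx
    induction hx using Submodule.mul_induction_on' with
    | mem_mul_mem m hm n hn =>
      rw [mul_comm m, ← mul_assoc]
      exact ha n hn m hm
    | add x _ y _ hx hy =>
      rw [mul_add, map_add]
      exact add_mem hx hy

variable (Z Q K)

/-- For `Z`-lattices `I`, `J` in the étale algebra `K`, one has `I^t · J = (I : J)^t`,
where `(I : J) = {a ∈ K : aJ ⊆ I}` is realized as `I / J`. -/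
theorem traceDual_mul_eq_traceDual_colon (I J : Submodule Z K)
    (hI : IsLat Z Q K I) (hJ : IsLat Z Q K J) :
    tdual Z Q K I * J = tdual Z Q K (I / J) := by
  rw [← (hI.tdual.mul hJ).tdual_tdual, tdual_mul, hI.tdual_tdual]
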